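/- arXiv:2008.05547 — 3 statements merged into one kernel-verified Lean document; each statement's English description precedes it below -/
import Mathlib

section
/- Let V be a finite-dimensional vector space over F2. Then ē(V^⊗3) = 0 if and only if dim_{F2} V ≤ 1. -/
open TensorProduct

/-- Let `V` be a finite-dimensional vector space over `F2`, and let `E` be
the `F2`-linear endomorphism of `V ⊗ V ⊗ V` determined by
`E(v1 ⊗ v2 ⊗ v3) = v1⊗v2⊗v3 + v2⊗v1⊗v3 + v3⊗v2⊗v1 + v2⊗v3⊗v1` (the action of
`ē = 1 + (1 2) + (1 3) + (1 3 2)`). Then `ē(V^⊗3) = 0` iff `dim_{F2} V ≤ 1`. -/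
theorem ebar_vanishes_iff_dim_le_one
    (V : Type*) [AddCommGroup V] [Module (ZMod 2) V] [FiniteDimensional (ZMod 2) V]
    (E : V ⊗[ZMod 2] (V ⊗[ZMod 2] V) →ₗ[ZMod 2] V ⊗[ZMod 2] (V ⊗[ZMod 2] V))
    (hE : ∀ v1 v2 v3 : V, E (v1 ⊗ₜ (v2 ⊗ₜ v3)) =
      v1 ⊗ₜ (v2 ⊗ₜ v3) + v2 ⊗ₜ (v1 ⊗ₜ v3) + v3 ⊗ₜ (v2 ⊗ₜ v1) + v2 ⊗ₜ (v3 ⊗ₜ v1)) :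
    LinearMap.range E = ⊥ ↔ Module.finrank (ZMod 2) V ≤ 1 := by
  rw [LinearMap.range_eq_bot]
  constructor
  · intro h0
    by_contra hlt
    push Not at hlt
    let b := Module.finBasis (ZMod 2) V
    let i : Fin (Module.finrank (ZMod 2) V) := ⟨0, by omega⟩
    let j : Fin (Module.finrank (ZMod 2) V) := ⟨1, hlt⟩
    have hij : i ≠ j := by simp [i, j]
    have h := hE (b i) (b i) (b j)
    rw [h0] at h
    have h2 := congrArg (fun t => (b.tensorProduct (b.tensorProduct b)).repr t (j, (i, i))) h
    simp [Module.Basis.tensorProduct_repr_tmul_apply, Finsupp.single_apply, hij, hij.symm] at h2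
  · intro h
    obtain ⟨v, hv⟩ := finrank_le_one_iff.mp h
    have h2 : ∀ t : V ⊗[ZMod 2] (V ⊗[ZMod 2] V), t + t = 0 := by
      intro t
      rw [← two_smul (ZMod 2) t, show (2 : ZMod 2) = 0 from rfl, zero_smul]
    apply TensorProduct.ext'
    intro x t
    induction t using TensorProduct.induction_on with
    | zero => simp
    | add a c ha hc => rw [TensorProduct.tmul_add, map_add, ha, hc]; simp
    | tmul y z =>
      obtain ⟨a, rfl⟩ := hv x
      obtain ⟨c, rfl⟩ := hv y
      obtain ⟨d, rfl⟩ := hv z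
      simp only [TensorProduct.tmul_smul, ← TensorProduct.smul_tmul', map_smul, hE, h2]
      simp [h2]
end

section
/- Let V be an F2-vector space with dim_{F2} V = 2. Then dim_{F2} ē(V^⊗3) = 2. -/
open TensorProduct

/-- Let `V` be an `F2`-vector space with `dim_{F2} V = 2`, and let `E` be
the `F2`-linear endomorphism of `V ⊗ V ⊗ V` determined by
`E(v1 ⊗ v2 ⊗ v3) = v1⊗v2⊗v3 + v2⊗v1⊗v3 + v3⊗v2⊗v1 + v2⊗v3⊗v1` (the action of
`ē = 1 + (1 2) + (1 3) + (1 3 2)`). Then `dim_{F2} ē(V^⊗3) = 2`. -/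
theorem ebar_dim_two_case
    (V : Type*) [AddCommGroup V] [Module (ZMod 2) V]
    (hV : Module.finrank (ZMod 2) V = 2)
    (E : V ⊗[ZMod 2] (V ⊗[ZMod 2] V) →ₗ[ZMod 2] V ⊗[ZMod 2] (V ⊗[ZMod 2] V))
    (hE : ∀ v1 v2 v3 : V, E (v1 ⊗ₜ (v2 ⊗ₜ v3)) =
      v1 ⊗ₜ (v2 ⊗ₜ v3) + v2 ⊗ₜ (v1 ⊗ₜ v3) + v3 ⊗ₜ (v2 ⊗ₜ v1) + v2 ⊗ₜ (v3 ⊗ₜ v1)) :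
    Module.finrank (ZMod 2) ↥(LinearMap.range E) = 2 := by
  have h2 : ∀ x : V ⊗[ZMod 2] (V ⊗[ZMod 2] V), x + x = 0 := fun x => by
    rw [← two_smul (ZMod 2) x, show (2 : ZMod 2) = 0 from rfl, zero_smul]
  have hfin : Module.Finite (ZMod 2) V := Module.finite_of_finrank_eq_succ hV
  let b : Module.Basis (Fin 2) (ZMod 2) V := Module.finBasisOfFinrankEq (ZMod 2) V hV
  let B := b.tensorProduct (b.tensorProduct b)
  let u : V ⊗[ZMod 2] (V ⊗[ZMod 2] V) := b 1 ⊗ₜ (b 0 ⊗ₜ b 0) + b 0 ⊗ₜ (b 1 ⊗ₜ b 0)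
  let w : V ⊗[ZMod 2] (V ⊗[ZMod 2] V) := b 0 ⊗ₜ (b 1 ⊗ₜ b 1) + b 1 ⊗ₜ (b 0 ⊗ₜ b 1)
  have hB : ∀ i j k, B (i, j, k) = b i ⊗ₜ (b j ⊗ₜ b k) := fun i j k => by
    simp [B, Module.Basis.tensorProduct_apply]
  have hu : u = B (1, 0, 0) + B (0, 1, 0) := by rw [hB, hB]
  have hw : w = B (0, 1, 1) + B (1, 0, 1) := by rw [hB, hB]
  have e001 : E (B (0, 0, 1)) = u := by
    rw [hB, hE, h2, zero_add]
  have e110 : E (B (1, 1, 0)) = w := by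
    rw [hB, hE, h2, zero_add]
  have hrange : LinearMap.range E = Submodule.span (ZMod 2) (Set.range ![u, w]) := by
    have hmu : u ∈ Submodule.span (ZMod 2) (Set.range ![u, w]) :=
      Submodule.subset_span ⟨0, rfl⟩
    have hmw : w ∈ Submodule.span (ZMod 2) (Set.range ![u, w]) :=
      Submodule.subset_span ⟨1, rfl⟩
    apply le_antisymm
    · rw [LinearMap.range_eq_map, ← B.span_eq, Submodule.map_span, Submodule.span_le]
      rintro _ ⟨_, ⟨⟨i, j, k⟩, rfl⟩, rfl⟩
      have key : E (B (i, j, k)) = 0 ∨ E (B (i, j, k)) = u ∨ E (B (i, j, k)) = w := by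
        fin_cases i <;> fin_cases j <;> fin_cases k
        · left
          change E (B (0, 0, 0)) = 0
          rw [hB, hE, h2, zero_add, h2]
        · exact Or.inr (Or.inl e001)
        · left
          change E (B (0, 1, 0)) = 0
          rw [hB, hE, add_assoc, h2]
        · right; right
          change E (B (0, 1, 1)) = w
          rw [hB, hE, add_assoc, h2, add_zero]
        · right; left
          change E (B (1, 0, 0)) = u
          rw [hB, hE, add_assoc, h2, add_zero]
        · left
          change E (B (1, 0, 1)) = 0
          rw [hB, hE, add_assoc, h2]
        · exact Or.inr (Or.inr e110)
        · left
          change E (B (1, 1, 1)) = 0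
          rw [hB, hE, h2, zero_add, h2]
      rcases key with h | h | h
      · rw [SetLike.mem_coe, h]; exact Submodule.zero_mem _
      · rw [SetLike.mem_coe, h]; exact hmu
      · rw [SetLike.mem_coe, h]; exact hmw
    · rw [Submodule.span_le]
      rintro _ ⟨i, rfl⟩
      fin_cases i
      · exact ⟨_, e001⟩
      · exact ⟨_, e110⟩
  have hli : LinearIndependent (ZMod 2) ![u, w] := by
    rw [LinearIndependent.pair_iff]
    intro s t hst
    rw [hu, hw] at hst
    have h := congrArg B.repr hst
    have h0 := DFunLike.congr_fun h (1, 0, 0)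
    have h1 := DFunLike.congr_fun h (0, 1, 1)
    simp [Finsupp.single_apply] at h0 h1
    exact ⟨h0, h1⟩
  rw [hrange, finrank_span_eq_card hli, Fintype.card_fin]
end

section
/- Let V be an F2-vector space with dim_{F2} V = 3. Then dim_{F2} ē(V^⊗3) = 8. -/
open TensorProduct

/-- Matrix of the map in the standard tensor basis. -/
def ebarMat : Matrix (Fin 3 × Fin 3 × Fin 3) (Fin 3 × Fin 3 × Fin 3) (ZMod 2) :=
  fun j i => (if j = (i.1, i.2.1, i.2.2) then 1 else 0) + (if j = (i.2.1, i.1, i.2.2) then 1 else 0)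
    + (if j = (i.2.2, i.2.1, i.1) then 1 else 0) + (if j = (i.2.1, i.2.2, i.1) then 1 else 0)

/-- Eight columns of the matrix that span its column space. -/
def ebarCol : Fin 8 → Fin 3 × Fin 3 × Fin 3 :=
  ![(0,0,1), (0,0,2), (1,1,0), (1,1,2), (2,2,0), (2,2,1), (0,1,2), (0,2,1)]

/-- Eight rows that detect those columns. -/
def ebarRow : Fin 8 → Fin 3 × Fin 3 × Fin 3 :=
  ![(1,0,0), (2,0,0), (0,1,1), (2,1,1), (0,2,2), (1,2,2), (0,1,2), (0,2,1)]

lemma ebarMat_one : ebarMat.submatrix ebarRow ebarCol = 1 := by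
  have h : ∀ i j, ebarMat (ebarRow i) (ebarCol j) = if i = j then 1 else 0 := by decide +kernel
  ext i j
  rw [Matrix.submatrix_apply, h, Matrix.one_apply]

lemma ebarMat_factor :
    ebarMat = ebarMat.submatrix id ebarCol * ebarMat.submatrix ebarRow id := by
  have h : ∀ a b c d e f : Fin 3, ebarMat (a, b, c) (d, e, f) =
      ∑ k, ebarMat (a, b, c) (ebarCol k) * ebarMat (ebarRow k) (d, e, f) := by
    decide +kernel
  ext i j
  rw [Matrix.mul_apply]
  exact h i.1 i.2.1 i.2.2 j.1 j.2.1 j.2.2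

lemma ebarMat_rank : ebarMat.rank = 8 := by
  apply le_antisymm
  · rw [ebarMat_factor]
    refine (Matrix.rank_mul_le_left _ _).trans ?_
    simpa using Matrix.rank_le_card_width (ebarMat.submatrix id ebarCol)
  · have h := Matrix.rank_submatrix_le ebarMat ebarRow ebarCol
    rw [ebarMat_one, Matrix.rank_one] at h
    simpa using h

/-- Let `V` be an `F2`-vector space with `dim_{F2} V = 3`, and let `E` be
the `F2`-linear endomorphism of `V ⊗ V ⊗ V` determined by
`E(v1 ⊗ v2 ⊗ v3) = v1⊗v2⊗v3 + v2⊗v1⊗v3 + v3⊗v2⊗v1 + v2⊗v3⊗v1` (the action of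
`ē = 1 + (1 2) + (1 3) + (1 3 2)`). Then `dim_{F2} ē(V^⊗3) = 8`. -/
theorem ebar_dim_three_case
    (V : Type*) [AddCommGroup V] [Module (ZMod 2) V]
    (hV : Module.finrank (ZMod 2) V = 3)
    (E : V ⊗[ZMod 2] (V ⊗[ZMod 2] V) →ₗ[ZMod 2] V ⊗[ZMod 2] (V ⊗[ZMod 2] V))
    (hE : ∀ v1 v2 v3 : V, E (v1 ⊗ₜ (v2 ⊗ₜ v3)) =
      v1 ⊗ₜ (v2 ⊗ₜ v3) + v2 ⊗ₜ (v1 ⊗ₜ v3) + v3 ⊗ₜ (v2 ⊗ₜ v1) + v2 ⊗ₜ (v3 ⊗ₜ v1)) :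
    Module.finrank (ZMod 2) ↥(LinearMap.range E) = 8 := by
  have b : Module.Basis (Fin 3) (ZMod 2) V :=
    have : Module.Finite (ZMod 2) V := Module.finite_of_finrank_pos (by omega)
    Module.finBasisOfFinrankEq (ZMod 2) V hV
  let bb := b.tensorProduct (b.tensorProduct b)
  have hM : E = Matrix.toLin bb bb ebarMat := by
    apply bb.ext
    rintro ⟨i, j, k⟩
    rw [Matrix.toLin_self]
    simp only [ebarMat, add_smul, Finset.sum_add_distrib, ite_smul, one_smul, zero_smul,
      Finset.sum_ite_eq', Finset.mem_univ, if_true]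
    simp only [bb, Module.Basis.tensorProduct_apply, hE]
  rw [hM, ← Matrix.rank_eq_finrank_range_toLin, ebarMat_rank]
end
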